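/- Let D = (V, A) be a digraph and k a positive integer, and let S ⊆ (V × V) \ A be a loopless arc set of minimum size such that D + S is k-anonymous (assuming such a set exists). Then Δ_{D+S} ≤ 4k(Δ_D + 2)² + Δ_D. -/

import Mathlib

/-- Indegree of vertex `v` in the digraph with arc set `A`. -/
def inDeg {V : Type*} [DecidableEq V] (A : Finset (V × V)) (v : V) : ℕ :=
  (A.filter fun a => a.2 = v).card

/-- Outdegree of vertex `v` in the digraph with arc set `A`. -/
def outDeg {V : Type*} [DecidableEq V] (A : Finset (V × V)) (v : V) : ℕ :=
  (A.filter fun a => a.1 = v).card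

/-- Degree pair (indegree, outdegree) of vertex `v`. -/
def deg {V : Type*} [DecidableEq V] (A : Finset (V × V)) (v : V) : ℕ × ℕ :=
  (inDeg A v, outDeg A v)

/-- Maximum in- or outdegree in the digraph with arc set `A`. -/
def maxDeg {V : Type*} [Fintype V] [DecidableEq V] (A : Finset (V × V)) : ℕ :=
  Finset.univ.sup fun v => max (inDeg A v) (outDeg A v)

/-- The digraph with arc set `A` is `k`-anonymous: every vertex shares its
degree pair with at least `k` vertices (itself included). -/
def kAnonymous {V : Type*} [Fintype V] [DecidableEq V]
    (A : Finset (V × V)) (k : ℕ) : Prop :=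
  ∀ v : V, k ≤ (Finset.univ.filter fun u : V => deg A u = deg A v).card

section Degrees

variable {V : Type*} [DecidableEq V]

lemma inDeg_insert {S : Finset (V × V)} {a : V × V} (ha : a ∉ S) (w : V) :
    inDeg (insert a S) w = inDeg S w + if a.2 = w then 1 else 0 := by
  unfold inDeg
  rw [Finset.filter_insert]
  split_ifs with h
  · rw [Finset.card_insert_of_notMem (by simp [ha])]
  · rfl

lemma outDeg_insert {S : Finset (V × V)} {a : V × V} (ha : a ∉ S) (w : V) :
    outDeg (insert a S) w = outDeg S w + if a.1 = w then 1 else 0 := by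
  unfold outDeg
  rw [Finset.filter_insert]
  split_ifs with h
  · rw [Finset.card_insert_of_notMem (by simp [ha])]
  · rfl

lemma inDeg_erase {S : Finset (V × V)} {a : V × V} (ha : a ∈ S) (w : V) :
    inDeg (S.erase a) w + (if a.2 = w then 1 else 0) = inDeg S w := by
  rw [← inDeg_insert (Finset.notMem_erase a S), Finset.insert_erase ha]

lemma outDeg_erase {S : Finset (V × V)} {a : V × V} (ha : a ∈ S) (w : V) :
    outDeg (S.erase a) w + (if a.1 = w then 1 else 0) = outDeg S w := by
  rw [← outDeg_insert (Finset.notMem_erase a S), Finset.insert_erase ha]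

lemma inDeg_union {A S : Finset (V × V)} (h : ∀ a ∈ S, a ∉ A) (w : V) :
    inDeg (A ∪ S) w = inDeg A w + inDeg S w := by
  unfold inDeg
  rw [Finset.filter_union, Finset.card_union_of_disjoint]
  refine Finset.disjoint_filter_filter ?_
  exact Finset.disjoint_left.2 fun a haA haS => h a haS haA

lemma outDeg_union {A S : Finset (V × V)} (h : ∀ a ∈ S, a ∉ A) (w : V) :
    outDeg (A ∪ S) w = outDeg A w + outDeg S w := by
  unfold outDeg
  rw [Finset.filter_union, Finset.card_union_of_disjoint]
  refine Finset.disjoint_filter_filter ?_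
  exact Finset.disjoint_left.2 fun a haA haS => h a haS haA

lemma sum_inDeg_eq_card_filter (S : Finset (V × V)) (B : Finset V) :
    ∑ v ∈ B, inDeg S v = (S.filter fun a => a.2 ∈ B).card := by
  rw [Finset.card_eq_sum_card_fiberwise (f := Prod.snd) (t := B) (fun a ha => by simp_all)]
  refine Finset.sum_congr rfl fun v hv => ?_
  unfold inDeg
  congr 1
  ext a
  simp only [Finset.mem_filter]
  grind

lemma sum_outDeg_eq_card_filter (S : Finset (V × V)) (B : Finset V) :
    ∑ v ∈ B, outDeg S v = (S.filter fun a => a.1 ∈ B).card := by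
  rw [Finset.card_eq_sum_card_fiberwise (f := Prod.fst) (t := B) (fun a ha => by simp_all)]
  refine Finset.sum_congr rfl fun v hv => ?_
  unfold outDeg
  congr 1
  ext a
  simp only [Finset.mem_filter]
  grind

variable [Fintype V]

lemma sum_inDeg (S : Finset (V × V)) : ∑ v, inDeg S v = S.card := by
  simp [sum_inDeg_eq_card_filter]

lemma sum_outDeg (S : Finset (V × V)) : ∑ v, outDeg S v = S.card := by
  simp [sum_outDeg_eq_card_filter]

lemma inDeg_le_maxDeg (A : Finset (V × V)) (v : V) : inDeg A v ≤ maxDeg A :=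
  (le_max_left _ _).trans
    (Finset.le_sup (f := fun v => max (inDeg A v) (outDeg A v)) (Finset.mem_univ v))

lemma outDeg_le_maxDeg (A : Finset (V × V)) (v : V) : outDeg A v ≤ maxDeg A :=
  (le_max_right _ _).trans
    (Finset.le_sup (f := fun v => max (inDeg A v) (outDeg A v)) (Finset.mem_univ v))

lemma inDeg_le_card (S : Finset (V × V)) (v : V) : inDeg S v ≤ Fintype.card V := by
  refine Finset.card_le_card_of_injOn Prod.fst (fun _ _ => Finset.mem_univ _) ?_
  intro a ha b hb h
  simp only [Finset.coe_filter, Set.mem_ofPred_eq] at ha hb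
  exact Prod.ext h (ha.2.trans hb.2.symm)

lemma outDeg_le_card (S : Finset (V × V)) (v : V) : outDeg S v ≤ Fintype.card V := by
  refine Finset.card_le_card_of_injOn Prod.snd (fun _ _ => Finset.mem_univ _) ?_
  intro a ha b hb h
  simp only [Finset.coe_filter, Set.mem_ofPred_eq] at ha hb
  exact Prod.ext (ha.2.trans hb.2.symm) h

/-- The heads `w` for which the arc `(u, w)` is a loop or already present. -/
def blockedHeads (A S : Finset (V × V)) (u : V) : Finset V :=
  Finset.univ.filter fun w => u = w ∨ (u, w) ∈ A ∨ (u, w) ∈ S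

/-- The tails `w` for which the arc `(w, v)` is a loop or already present. -/
def blockedTails (A S : Finset (V × V)) (v : V) : Finset V :=
  Finset.univ.filter fun w => w = v ∨ (w, v) ∈ A ∨ (w, v) ∈ S

lemma card_blockedHeads_le (A S : Finset (V × V)) (u : V) :
    (blockedHeads A S u).card ≤ 1 + outDeg A u + outDeg S u := by
  have hsub : blockedHeads A S u ⊆ ({u} ∪ (A.filter fun a => a.1 = u).image Prod.snd) ∪
      (S.filter fun a => a.1 = u).image Prod.snd := by
    intro w hw
    simp only [blockedHeads, Finset.mem_filter, Finset.mem_univ, true_and] at hw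
    simp only [Finset.mem_union, Finset.mem_singleton, Finset.mem_image, Finset.mem_filter]
    rcases hw with h | h | h
    · exact Or.inl (Or.inl h.symm)
    · exact Or.inl (Or.inr ⟨_, ⟨h, rfl⟩, rfl⟩)
    · exact Or.inr ⟨_, ⟨h, rfl⟩, rfl⟩
  refine (Finset.card_le_card hsub).trans ((Finset.card_union_le _ _).trans ?_)
  refine Nat.add_le_add ((Finset.card_union_le _ _).trans ?_) Finset.card_image_le
  exact Nat.add_le_add (Finset.card_singleton u).le Finset.card_image_le

lemma card_blockedTails_le (A S : Finset (V × V)) (v : V) :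
    (blockedTails A S v).card ≤ 1 + inDeg A v + inDeg S v := by
  have hsub : blockedTails A S v ⊆ ({v} ∪ (A.filter fun a => a.2 = v).image Prod.fst) ∪
      (S.filter fun a => a.2 = v).image Prod.fst := by
    intro w hw
    simp only [blockedTails, Finset.mem_filter, Finset.mem_univ, true_and] at hw
    simp only [Finset.mem_union, Finset.mem_singleton, Finset.mem_image, Finset.mem_filter]
    rcases hw with h | h | h
    · exact Or.inl (Or.inl h)
    · exact Or.inl (Or.inr ⟨_, ⟨h, rfl⟩, rfl⟩)
    · exact Or.inr ⟨_, ⟨h, rfl⟩, rfl⟩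
  refine (Finset.card_le_card hsub).trans ((Finset.card_union_le _ _).trans ?_)
  refine Nat.add_le_add ((Finset.card_union_le _ _).trans ?_) Finset.card_image_le
  exact Nat.add_le_add (Finset.card_singleton v).le Finset.card_image_le

/-- `S` can be added to the digraph `A` without exceeding the in-demands `x` and the
out-demands `y`. -/
structure IsPartialRealization (A : Finset (V × V)) (x y : V → ℕ) (S : Finset (V × V)) :
    Prop where
  notMem : ∀ a ∈ S, a ∉ A
  loopless : ∀ v : V, (v, v) ∉ S
  inDeg_le : ∀ v, inDeg S v ≤ x v
  outDeg_le : ∀ v, outDeg S v ≤ y v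

namespace IsPartialRealization

variable {A S : Finset (V × V)} {x y : V → ℕ}

lemma insert_arc (hS : IsPartialRealization A x y S) {u v : V} (hu : outDeg S u < y u)
    (hv : inDeg S v < x v) (huv : v ∉ blockedHeads A S u) :
    IsPartialRealization A x y (insert (u, v) S) := by
  simp only [blockedHeads, Finset.mem_filter, Finset.mem_univ, true_and, not_or] at huv
  obtain ⟨hne, hA, hSuv⟩ := huv
  refine ⟨?_, ?_, ?_, ?_⟩
  · intro a ha
    rcases Finset.mem_insert.1 ha with rfl | ha
    · exact hA
    · exact hS.notMem a ha
  · intro w hw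
    rcases Finset.mem_insert.1 hw with h | h
    · simp only [Prod.mk.injEq] at h
      exact hne (h.1.symm.trans h.2)
    · exact hS.loopless w h
  · intro w
    rw [inDeg_insert hSuv]
    have := hS.inDeg_le w
    split_ifs with h
    · simp only at h; subst h; exact hv
    · exact this
  · intro w
    rw [outDeg_insert hSuv]
    have := hS.outDeg_le w
    split_ifs with h
    · simp only at h; subst h; exact hu
    · exact this

/-- Rerouting the arc `(a, b)` through `u` and `v` enlarges a partial realization. -/
lemma exists_swap (hS : IsPartialRealization A x y S) {u v a b : V} (hu : outDeg S u < y u)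
    (hv : inDeg S v < x v) (hab : (a, b) ∈ S) (hub : b ∉ blockedHeads A S u)
    (hav : a ∉ blockedTails A S v) :
    ∃ S', IsPartialRealization A x y S' ∧ S'.card = S.card + 1 := by
  have hub' := hub
  simp only [blockedHeads, Finset.mem_filter, Finset.mem_univ, true_and, not_or] at hub'
  simp only [blockedTails, Finset.mem_filter, Finset.mem_univ, true_and, not_or] at hav
  have hau : a ≠ u := by rintro rfl; exact hub'.2.2 hab
  have hbv : b ≠ v := by rintro rfl; exact hav.2.2 hab
  have h1 : (u, b) ∉ S.erase (a, b) := fun h => hub'.2.2 (Finset.mem_of_mem_erase h)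
  have h2 : (a, v) ∉ insert (u, b) (S.erase (a, b)) := by
    intro h
    rcases Finset.mem_insert.1 h with h | h
    · exact hau (congrArg Prod.fst h)
    · exact hav.2.2 (Finset.mem_of_mem_erase h)
  refine ⟨insert (a, v) (insert (u, b) (S.erase (a, b))), ⟨?_, ?_, ?_, ?_⟩, ?_⟩
  · intro c hc
    rcases Finset.mem_insert.1 hc with rfl | hc
    · exact hav.2.1
    rcases Finset.mem_insert.1 hc with rfl | hc
    · exact hub'.2.1
    · exact hS.notMem c (Finset.mem_of_mem_erase hc)
  · intro w hw
    rcases Finset.mem_insert.1 hw with h | hw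
    · simp only [Prod.mk.injEq] at h
      exact hav.1 (h.1.symm.trans h.2)
    rcases Finset.mem_insert.1 hw with h | hw
    · simp only [Prod.mk.injEq] at h
      exact hub'.1 (h.1.symm.trans h.2)
    · exact hS.loopless w (Finset.mem_of_mem_erase hw)
  · intro w
    rw [inDeg_insert h2, inDeg_insert h1]
    have e := inDeg_erase hab w
    have := hS.inDeg_le w
    simp only at e ⊢
    by_cases hw : v = w
    · subst hw
      simp only [hbv, if_false, if_true] at e ⊢
      omega
    · simp only [hw, if_false] at e ⊢
      omega
  · intro w
    rw [outDeg_insert h2, outDeg_insert h1]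
    have e := outDeg_erase hab w
    have := hS.outDeg_le w
    simp only at e ⊢
    by_cases hw : u = w
    · subst hw
      simp only [hau, if_false, if_true] at e ⊢
      omega
    · simp only [hw, if_false] at e ⊢
      omega
  · rw [Finset.card_insert_of_notMem h2, Finset.card_insert_of_notMem h1,
      Finset.card_erase_of_mem hab]
    have := Finset.card_pos.2 ⟨_, hab⟩
    omega

end IsPartialRealization

/-- Bounded balanced demands of sufficiently large total are realizable. -/
lemma exists_realization (A : Finset (V × V)) (x y : V → ℕ) (ξ M : ℕ)
    (hx : ∀ v, x v ≤ ξ) (hy : ∀ v, y v ≤ ξ) (hxM : ∑ v, x v = M) (hyM : ∑ v, y v = M)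
    (hM : 3 * (ξ * (maxDeg A + ξ)) < M) :
    ∃ S : Finset (V × V), (∀ a ∈ S, a ∉ A) ∧ (∀ v : V, (v, v) ∉ S) ∧
      (∀ v, inDeg S v = x v) ∧ (∀ v, outDeg S v = y v) := by
  classical
  have h0 : IsPartialRealization A x y ∅ := ⟨by simp, by simp, by simp [inDeg], by simp [outDeg]⟩
  obtain ⟨S, hSmem, hmax⟩ := Finset.exists_max_image
    (Finset.univ.filter fun S : Finset (V × V) => IsPartialRealization A x y S) Finset.card
    ⟨∅, by simpa using h0⟩
  have hS : IsPartialRealization A x y S := by simpa using hSmem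
  replace hmax : ∀ S', IsPartialRealization A x y S' → S'.card ≤ S.card :=
    fun S' h => hmax S' (by simpa using h)
  have hle : S.card ≤ M := by
    rw [← sum_inDeg, ← hxM]
    exact Finset.sum_le_sum fun v _ => hS.inDeg_le v
  rcases hle.eq_or_lt with heq | hlt
  · refine ⟨S, hS.notMem, hS.loopless, fun v => ?_, fun v => ?_⟩
    · exact (Finset.sum_eq_sum_iff_of_le fun v _ => hS.inDeg_le v).1
        (by rw [sum_inDeg, heq, hxM]) v (Finset.mem_univ v)
    · exact (Finset.sum_eq_sum_iff_of_le fun v _ => hS.outDeg_le v).1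
        (by rw [sum_outDeg, heq, hyM]) v (Finset.mem_univ v)
  exfalso
  obtain ⟨v, -, hv⟩ : ∃ v ∈ Finset.univ, inDeg S v < x v :=
    Finset.exists_lt_of_sum_lt (by rw [sum_inDeg, hxM]; exact hlt)
  obtain ⟨u, -, hu⟩ : ∃ u ∈ Finset.univ, outDeg S u < y u :=
    Finset.exists_lt_of_sum_lt (by rw [sum_outDeg, hyM]; exact hlt)
  have hBu : (blockedHeads A S u).card ≤ maxDeg A + ξ := by
    have := card_blockedHeads_le A S u
    have := outDeg_le_maxDeg A u
    have := hy u
    omega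
  have hBv : (blockedTails A S v).card ≤ maxDeg A + ξ := by
    have := card_blockedTails_le A S v
    have := inDeg_le_maxDeg A v
    have := hx v
    omega
  have hdef : ∀ w, inDeg S w < x w → w ∈ blockedHeads A S u := by
    intro w hw
    by_contra hb
    have h1 := hmax _ (hS.insert_arc hu hw hb)
    simp only [blockedHeads, Finset.mem_filter, Finset.mem_univ, true_and, not_or] at hb
    rw [Finset.card_insert_of_notMem hb.2.2] at h1
    omega
  have hswap : ∀ a ∈ S, a.2 ∈ blockedHeads A S u ∨ a.1 ∈ blockedTails A S v := by
    rintro ⟨a, b⟩ hab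
    by_contra! hb
    obtain ⟨S', hS', hcard⟩ := hS.exists_swap hu hv hab hb.1 hb.2
    have := hmax _ hS'
    omega
  have hScard : S.card ≤ 2 * (ξ * (maxDeg A + ξ)) := by
    have hsub : S ⊆ (S.filter fun a => a.2 ∈ blockedHeads A S u) ∪
        (S.filter fun a => a.1 ∈ blockedTails A S v) := by
      intro a ha
      rcases hswap a ha with h | h <;> simp [ha, h]
    refine (Finset.card_le_card hsub).trans ((Finset.card_union_le _ _).trans ?_)
    rw [← sum_inDeg_eq_card_filter, ← sum_outDeg_eq_card_filter]
    have h1 := Finset.sum_le_card_nsmul (blockedHeads A S u) (inDeg S) ξ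
      fun w _ => (hS.inDeg_le w).trans (hx w)
    have h2 := Finset.sum_le_card_nsmul (blockedTails A S v) (outDeg S) ξ
      fun w _ => (hS.outDeg_le w).trans (hy w)
    rw [smul_eq_mul] at h1 h2
    nlinarith [Nat.mul_le_mul_right ξ hBu, Nat.mul_le_mul_right ξ hBv]
  have hMle : M ≤ S.card + ξ * (maxDeg A + ξ) := by
    calc M = ∑ w, x w := hxM.symm
      _ ≤ ∑ w, (inDeg S w + if w ∈ blockedHeads A S u then ξ else 0) := by
          refine Finset.sum_le_sum fun w _ => ?_
          have h1 := hdef w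
          have h2 := hx w
          split_ifs with h
          · omega
          · have : ¬ inDeg S w < x w := fun h' => h (h1 h')
            omega
      _ = S.card + (blockedHeads A S u).card * ξ := by
          rw [Finset.sum_add_distrib, sum_inDeg, Finset.sum_ite_mem, Finset.univ_inter,
            Finset.sum_const, smul_eq_mul]
      _ ≤ _ := by nlinarith [Nat.mul_le_mul_right ξ hBu]
  omega

end Degrees

/-- Block sizes `c i` of total `p`, such that splitting `m i` into `c i` and the rest
leaves no nonempty part smaller than `k`. -/
lemma exists_splitting {ι : Type*} [DecidableEq ι] (m : ι → ℕ) (k : ℕ)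
    (hm : ∀ i, m i = 0 ∨ k ≤ m i) (i₀ : ι) (h₀ : 4 * k ≤ m i₀) (s : Finset ι) (hs : i₀ ∉ s) :
    ∀ p, k ≤ p → p + k ≤ m i₀ + ∑ i ∈ s, m i →
      ∃ c : ι → ℕ, c i₀ + ∑ i ∈ s, c i = p ∧
        ∀ i, (c i = 0 ∨ k ≤ c i) ∧ (c i = m i ∨ c i + k ≤ m i) := by
  have hzero : ∀ i, (0 : ℕ) = m i ∨ 0 + k ≤ m i := fun i => by have := hm i; omega
  induction s using Finset.induction_on with
  | empty =>
    intro p h1 h2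
    refine ⟨fun i => if i = i₀ then p else 0, by simp, fun i => ?_⟩
    have := hzero i
    simp only
    split_ifs with h
    · subst h
      simp only [Finset.sum_empty] at h2
      omega
    · omega
  | insert j s hj ih =>
    intro p h1 h2
    simp only [Finset.mem_insert, not_or] at hs
    have ih' := ih hs.2
    rw [Finset.sum_insert hj] at h2
    suffices ∃ q r, q + r = p ∧ k ≤ r ∧ r + k ≤ m i₀ + ∑ i ∈ s, m i ∧
        (q = 0 ∨ k ≤ q) ∧ (q = m j ∨ q + k ≤ m j) by
      obtain ⟨q, r, hqr, hr1, hr2, hq⟩ := this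
      obtain ⟨c, hc, hc'⟩ := ih' r hr1 hr2
      refine ⟨Function.update c j q, ?_, fun i => ?_⟩
      · have hupd : ∑ i ∈ s, Function.update c j q i = ∑ i ∈ s, c i :=
          Finset.sum_congr rfl fun i hi =>
            Function.update_of_ne (show i ≠ j by rintro rfl; exact hj hi) q c
        rw [Finset.sum_insert hj, Function.update_self, Function.update_of_ne hs.1, hupd]
        omega
      · by_cases hij : i = j
        · subst hij; simpa using hq
        · rw [Function.update_of_ne hij]; exact hc' i
    have hmj := hm j
    have hzj := hzero j
    set N := m i₀ + ∑ i ∈ s, m i with hN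
    have hN4 : 4 * k ≤ N := by omega
    by_cases hA : p + k ≤ N
    · exact ⟨0, p, by omega, h1, hA, by omega, by omega⟩
    by_cases hB : m j + k ≤ p
    · exact ⟨m j, p - m j, by omega, by omega, by omega, by omega, by omega⟩
    by_cases hC : p + k ≤ m j + k
    · exact ⟨p - k - k, k + k, by omega, by omega, by omega, by omega, by omega⟩
    · exact ⟨m j - k, p - (m j - k), by omega, by omega, by omega, by omega, by omega⟩

section Types

variable {V : Type*} [Fintype V]

/-- Raising exactly `p` of the values of `f` by `e` while keeping all fibers of size at
least `k`. -/
lemma exists_raise [DecidableEq V] (f : V → ℕ × ℕ) (k : ℕ)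
    (hf : ∀ v, k ≤ (Finset.univ.filter fun u => f u = f v).card) (v₀ : V)
    (hv₀ : 4 * k ≤ (Finset.univ.filter fun u => f u = f v₀).card) (p : ℕ) (hp : k ≤ p)
    (hpV : p + k ≤ Fintype.card V) (e : ℕ × ℕ) :
    ∃ H : Finset V, H.card = p ∧ ∀ v, k ≤ (Finset.univ.filter fun u =>
      (if u ∈ H then f u + e else f u) = if v ∈ H then f v + e else f v).card := by
  set m : ℕ × ℕ → ℕ := fun t => (Finset.univ.filter fun u => f u = t).card with hm
  have hm0 : ∀ t, m t = 0 ∨ k ≤ m t := by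
    intro t
    rcases (Finset.univ.filter fun u => f u = t).eq_empty_or_nonempty with h | ⟨u, hu⟩
    · left; simp [hm, h]
    · right
      simp only [Finset.mem_filter, Finset.mem_univ, true_and] at hu
      subst hu
      exact hf u
  set s := Finset.univ.image f with hs
  have hmem : f v₀ ∈ s := Finset.mem_image_of_mem _ (Finset.mem_univ _)
  have hsum : m (f v₀) + ∑ t ∈ s.erase (f v₀), m t = Fintype.card V := by
    rw [Finset.add_sum_erase s m hmem, ← Finset.card_univ]
    exact (Finset.card_eq_sum_card_fiberwise fun v _ => by simp [hs]).symm
  obtain ⟨c, hc, hc'⟩ := exists_splitting m k hm0 (f v₀) hv₀ (s.erase (f v₀)) (by simp) p hp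
    (by rw [hsum]; exact hpV)
  rw [Finset.add_sum_erase s c hmem] at hc
  have hcm : ∀ t, c t ≤ m t := fun t => by have := (hc' t).2; omega
  choose B hBsub hBcard using fun t => Finset.exists_subset_card_eq (hcm t)
  have hBf : ∀ t u, u ∈ B t → f u = t := fun t u hu => by simpa using hBsub t hu
  have hfib : ∀ t, (Finset.univ.filter fun v => v ∈ B (f v)).filter (fun u => f u = t) = B t := by
    intro t
    ext u
    simp only [Finset.mem_filter, Finset.mem_univ, true_and]
    constructor
    · rintro ⟨h, rfl⟩; exact h
    · intro h
      have := hBf t u h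
      subst this
      exact ⟨h, rfl⟩
  refine ⟨Finset.univ.filter fun v => v ∈ B (f v), ?_, fun v => ?_⟩
  · rw [Finset.card_eq_sum_card_fiberwise (f := f) (t := s) (fun v _ => by simp [hs]), ← hc]
    exact Finset.sum_congr rfl fun t _ => by rw [hfib, hBcard]
  · by_cases hv : v ∈ B (f v)
    · have hpos : 0 < c (f v) := by rw [← hBcard]; exact Finset.card_pos.2 ⟨v, hv⟩
      have hk : k ≤ (B (f v)).card := by rw [hBcard]; have := (hc' (f v)).1; omega
      refine hk.trans (Finset.card_le_card fun u hu => ?_)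
      have huv := hBf _ u hu
      simp [huv, hu, hv]
    · have hlt : (B (f v)).card < m (f v) :=
        Finset.card_lt_card ⟨hBsub _, fun h => hv (h (by simp))⟩
      have hk : k ≤ ((Finset.univ.filter fun u => f u = f v) \ B (f v)).card := by
        rw [Finset.card_sdiff_of_subset (hBsub _)]
        have := (hc' (f v)).2
        rw [hBcard] at hlt ⊢
        change k ≤ m (f v) - c (f v)
        omega
      refine hk.trans (Finset.card_le_card fun u hu => ?_)
      simp only [Finset.mem_sdiff, Finset.mem_filter, Finset.mem_univ, true_and] at hu
      simp [hu.1, hu.2, hv]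

/-- A box with few cells has a cell containing at least `b` of the values of `f`. -/
lemma exists_large_fiber (f : V → ℕ × ℕ) (N₁ N₂ b : ℕ) (h₁ : ∀ v, (f v).1 < N₁)
    (h₂ : ∀ v, (f v).2 < N₂) (hb : N₁ * N₂ * b < Fintype.card V) :
    ∃ v₀, b ≤ (Finset.univ.filter fun u => f u = f v₀).card := by
  obtain ⟨t, -, ht⟩ := Finset.exists_lt_card_fiber_of_mul_lt_card_of_maps_to
    (s := (Finset.univ : Finset V)) (t := Finset.range N₁ ×ˢ Finset.range N₂) (f := f) (n := b)
    (fun v _ => by simp [h₁ v, h₂ v]) (by simpa using hb)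
  obtain ⟨v₀, hv₀⟩ := Finset.card_pos.1 (b.zero_le.trans_lt ht)
  simp only [Finset.mem_filter, Finset.mem_univ, true_and] at hv₀
  exact ⟨v₀, by rw [hv₀]; exact ht.le⟩

/-- Carrying undersized fibers upwards, cell by cell. -/
lemma exists_carry (d : V → ℕ × ℕ) (Δ k : ℕ) (hd₁ : ∀ v, (d v).1 ≤ Δ) (hd₂ : ∀ v, (d v).2 ≤ Δ)
    (t : ℕ) (ht : t < (Δ + 1) * (Δ + 1)) :
    ∃ f : V → ℕ × ℕ, (∀ v, d v ≤ f v) ∧ (∀ v, (f v).1 ≤ Δ) ∧ (∀ v, (f v).2 ≤ Δ) ∧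
      ∑ v, ((f v).1 + (f v).2) ≤ ∑ v, ((d v).1 + (d v).2) + k * t ∧
      ∀ v, (f v).1 * (Δ + 1) + (f v).2 < t →
        k ≤ (Finset.univ.filter fun u => f u = f v).card := by
  induction t with
  | zero => exact ⟨d, fun v => le_rfl, hd₁, hd₂, by simp, by simp⟩
  | succ t ih =>
    obtain ⟨f, hdf, h₁, h₂, hcost, hgood⟩ := ih (by omega)
    by_cases hall : ∀ v, (f v).1 * (Δ + 1) + (f v).2 = t →
        k ≤ (Finset.univ.filter fun u => f u = f v).card
    · refine ⟨f, hdf, h₁, h₂, hcost.trans (by gcongr; omega), fun v hv => ?_⟩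
      rcases Nat.lt_succ_iff_lt_or_eq.1 hv with h | h
      · exact hgood v h
      · exact hall v h
    push Not at hall
    obtain ⟨v₀, hv₀, hlt⟩ := hall
    obtain ⟨c, hc⟩ : ∃ c, c = f v₀ := ⟨_, rfl⟩
    rw [← hc] at hv₀ hlt
    obtain ⟨n, hcn, hn₁, hn₂, hn, hnr⟩ : ∃ n : ℕ × ℕ, c ≤ n ∧ n.1 ≤ Δ ∧ n.2 ≤ Δ ∧
        n.1 + n.2 = c.1 + c.2 + 1 ∧ t < n.1 * (Δ + 1) + n.2 := by
      have hc₁ : c.1 ≤ Δ := hc ▸ h₁ v₀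
      have hc₂ : c.2 ≤ Δ := hc ▸ h₂ v₀
      by_cases h : c.2 < Δ
      · exact ⟨(c.1, c.2 + 1), Prod.mk_le_mk.2 ⟨le_rfl, by simp⟩, hc₁, h, by simp; omega,
          by simp; omega⟩
      · have hc₁' : c.1 < Δ := by
          by_contra h'
          have e1 : c.1 = Δ := by omega
          have e2 : c.2 = Δ := by omega
          rw [e1, e2] at hv₀
          nlinarith
        refine ⟨(c.1 + 1, c.2), Prod.mk_le_mk.2 ⟨by simp, le_rfl⟩, hc₁', hc₂, by simp; omega, ?_⟩
        simp only
        nlinarith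
    refine ⟨fun u => if f u = c then n else f u, fun u => ?_, fun u => ?_, fun u => ?_, ?_,
      fun v hv => ?_⟩
    · simp only
      split_ifs with h
      · exact (hdf u).trans (h ▸ hcn)
      · exact hdf u
    · simp only
      split_ifs with h
      exacts [hn₁, h₁ u]
    · simp only
      split_ifs with h
      exacts [hn₂, h₂ u]
    · have hsum : ∀ u, (if f u = c then n else f u).1 + (if f u = c then n else f u).2 =
          ((f u).1 + (f u).2) + if f u = c then 1 else 0 := by
        intro u
        split_ifs with h
        · rw [h, hn]
        · rfl
      simp only [hsum]
      rw [Finset.sum_add_distrib, ← Finset.card_filter, mul_add, mul_one]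
      omega
    · have hvc : f v ≠ c := by
        intro h
        simp only [h, if_true] at hv
        omega
      simp only [hvc, if_false] at hv ⊢
      have hvt : (f v).1 * (Δ + 1) + (f v).2 ≠ t := by
        intro h
        apply hvc
        have hc₂ : c.2 ≤ Δ := hc ▸ h₂ v₀
        have hv₂ := h₂ v
        have key : ∀ a b : ℕ, b ≤ Δ → (a * (Δ + 1) + b) / (Δ + 1) = a := by
          intro a b hb
          rw [add_comm, Nat.add_mul_div_right _ _ (Nat.succ_pos Δ),
            Nat.div_eq_of_lt (by omega), zero_add]
        have e1 : (f v).1 = c.1 := by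
          rw [← key (f v).1 (f v).2 hv₂, ← key c.1 c.2 hc₂, h, hv₀]
        refine Prod.ext e1 ?_
        rw [e1] at h
        omega
      refine (hgood v (by omega)).trans (Finset.card_le_card fun u hu => ?_)
      simp only [Finset.mem_filter, Finset.mem_univ, true_and] at hu ⊢
      rw [if_neg (by rw [hu]; exact hvc), hu]

/-- Cheap anonymization of bounded degree pairs, ignoring realizability. -/
lemma exists_anonymous_above [DecidableEq V] (d : V → ℕ × ℕ) (Δ k : ℕ)
    (hd₁ : ∀ v, (d v).1 ≤ Δ) (hd₂ : ∀ v, (d v).2 ≤ Δ)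
    (hV : (Δ + 1) * (Δ + 1) * (2 * k) < Fintype.card V) :
    ∃ f : V → ℕ × ℕ, (∀ v, d v ≤ f v) ∧ (∀ v, (f v).1 ≤ Δ) ∧ (∀ v, (f v).2 ≤ Δ) ∧
      ∑ v, (f v).1 ≤ ∑ v, (d v).1 + k * (Δ + 2) ^ 2 ∧
      ∑ v, (f v).2 ≤ ∑ v, (d v).2 + k * (Δ + 2) ^ 2 ∧
      ∀ v, k ≤ (Finset.univ.filter fun u => f u = f v).card := by
  obtain ⟨f, hdf, h₁, h₂, hcost, hgood⟩ := exists_carry d Δ k hd₁ hd₂ ((Δ + 1) * (Δ + 1) - 1)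
    (by have : 0 < (Δ + 1) * (Δ + 1) := by positivity
        omega)
  have hl₁ : ∑ v, (d v).1 ≤ ∑ v, (f v).1 := Finset.sum_le_sum fun v _ => (hdf v).1
  have hl₂ : ∑ v, (d v).2 ≤ ∑ v, (f v).2 := Finset.sum_le_sum fun v _ => (hdf v).2
  rw [Finset.sum_add_distrib, Finset.sum_add_distrib] at hcost
  have hk : k * ((Δ + 1) * (Δ + 1) - 1) + k * Δ ≤ k * (Δ + 2) ^ 2 := by
    rw [← mul_add]
    gcongr
    have : (Δ + 1) * (Δ + 1) + Δ ≤ (Δ + 2) ^ 2 := by nlinarith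
    omega
  by_cases hall : ∀ v, k ≤ (Finset.univ.filter fun u => f u = f v).card
  · exact ⟨f, hdf, h₁, h₂, by omega, by omega, hall⟩
  push Not at hall
  obtain ⟨v₀, hv₀⟩ := hall
  have hroot : ∀ v, (Finset.univ.filter fun u => f u = f v).card < k → f v = (Δ, Δ) := by
    intro v hv
    by_contra hne
    refine absurd (hgood v ?_) (by omega)
    have e1 := h₁ v
    have e2 := h₂ v
    have : (f v).1 < Δ ∨ (f v).2 < Δ := by
      by_contra! h
      exact hne (Prod.ext (by simp; omega) (by simp; omega))
    apply Nat.lt_sub_of_add_lt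
    rcases this with h | h <;> nlinarith
  obtain ⟨w, hw⟩ := exists_large_fiber f (Δ + 1) (Δ + 1) (2 * k)
    (fun v => Nat.lt_succ_of_le (h₁ v)) (fun v => Nat.lt_succ_of_le (h₂ v)) hV
  obtain ⟨K, hKsub, hK⟩ := Finset.exists_subset_card_eq (show k ≤ _ by omega : k ≤
    (Finset.univ.filter fun u => f u = f w).card)
  have hKf : ∀ u ∈ K, f u = f w := fun u hu => by simpa using hKsub hu
  have hsum : ∀ g : ℕ × ℕ → ℕ, g (Δ, Δ) = Δ →
      ∑ v, g (if v ∈ K then (Δ, Δ) else f v) ≤ ∑ v, g (f v) + k * Δ := by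
    intro g hg
    calc ∑ v, g (if v ∈ K then (Δ, Δ) else f v)
        ≤ ∑ v, (g (f v) + if v ∈ K then Δ else 0) :=
          Finset.sum_le_sum fun v _ => by split_ifs <;> omega
      _ = _ := by
          rw [Finset.sum_add_distrib, Finset.sum_ite_mem, Finset.univ_inter, Finset.sum_const,
            smul_eq_mul, hK]
  have hs₁ := hsum Prod.fst rfl
  have hs₂ := hsum Prod.snd rfl
  refine ⟨fun u => if u ∈ K then (Δ, Δ) else f u, fun v => ?_, fun v => ?_, fun v => ?_,
    by simp only; omega, by simp only; omega, fun v => ?_⟩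
  · simp only
    split_ifs
    · exact ⟨hd₁ v, hd₂ v⟩
    · exact hdf v
  · simp only
    split_ifs
    · exact le_rfl
    · exact h₁ v
  · simp only
    split_ifs
    · exact le_rfl
    · exact h₂ v
  · by_cases hv : (if v ∈ K then (Δ, Δ) else f v) = (Δ, Δ)
    · simp only [hv]
      rw [← hK]
      exact Finset.card_le_card fun u hu => by simp [hu]
    · have hvK : v ∉ K := fun h => hv (by simp [h])
      simp only [hvK, if_false] at hv ⊢
      by_cases hvw : f v = f w
      · have hk' : k ≤ ((Finset.univ.filter fun u => f u = f w) \ K).card := by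
          rw [Finset.card_sdiff_of_subset hKsub]
          omega
        refine hk'.trans (Finset.card_le_card fun u hu => ?_)
        simp only [Finset.mem_sdiff, Finset.mem_filter, Finset.mem_univ, true_and] at hu
        simp [hu.1, hu.2, hvw]
      · have hk' : k ≤ (Finset.univ.filter fun u => f u = f v).card := by
          by_contra h
          exact hv (hroot v (by omega))
        refine hk'.trans (Finset.card_le_card fun u hu => ?_)
        simp only [Finset.mem_filter, Finset.mem_univ, true_and] at hu
        have huK : u ∉ K := fun h => hvw (hu ▸ hKf u h)
        simp [hu, huK]

end Types

/-- Large digraphs admit small insertion sets. -/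
lemma exists_small_insertion_set {V : Type*} [Fintype V] [DecidableEq V]
    (A : Finset (V × V)) (k : ℕ) (hk : 2 ≤ k)
    (hV : 4 * k * (maxDeg A + 2) ^ 2 < Fintype.card V) :
    ∃ S : Finset (V × V), (∀ a ∈ S, a ∉ A) ∧ (∀ v : V, (v, v) ∉ S) ∧ kAnonymous (A ∪ S) k ∧
      S.card ≤ 4 * k * (maxDeg A + 2) ^ 2 := by
  set Δ := maxDeg A with hΔ
  have hin : ∀ v, (deg A v).1 ≤ Δ := inDeg_le_maxDeg A
  have hout : ∀ v, (deg A v).2 ≤ Δ := outDeg_le_maxDeg A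
  obtain ⟨f, hdf, hf₁, hf₂, hs₁, hs₂, hf⟩ := exists_anonymous_above (deg A) Δ k hin hout
    (lt_of_le_of_lt (by nlinarith [Nat.zero_le (k * Δ), Nat.zero_le (k * Δ * Δ)]) hV)
  have hl₁ : ∑ v, (deg A v).1 ≤ ∑ v, (f v).1 := Finset.sum_le_sum fun v _ => (hdf v).1
  have hl₂ : ∑ v, (deg A v).2 ≤ ∑ v, (f v).2 := Finset.sum_le_sum fun v _ => (hdf v).2
  have hkq : 4 * k ≤ k * (Δ + 2) ^ 2 := by nlinarith [Nat.zero_le (k * Δ), Nat.zero_le (k * Δ * Δ)]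
  have hassoc : 4 * k * (Δ + 2) ^ 2 = 4 * (k * (Δ + 2) ^ 2) := by ring
  obtain ⟨M, hM⟩ : ∃ M, M + k = 4 * k * (Δ + 2) ^ 2 := ⟨4 * k * (Δ + 2) ^ 2 - k, by omega⟩
  obtain ⟨p, hp⟩ : ∃ p, ∑ v, (f v).1 + p = ∑ v, (deg A v).1 + M :=
    ⟨∑ v, (deg A v).1 + M - ∑ v, (f v).1, by omega⟩
  obtain ⟨q, hq⟩ : ∃ q, ∑ v, (f v).2 + q = ∑ v, (deg A v).2 + M :=
    ⟨∑ v, (deg A v).2 + M - ∑ v, (f v).2, by omega⟩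
  obtain ⟨v₁, hv₁⟩ := exists_large_fiber f (Δ + 1) (Δ + 1) (4 * k)
    (fun v => Nat.lt_succ_of_le (hf₁ v)) (fun v => Nat.lt_succ_of_le (hf₂ v))
    (lt_of_le_of_lt (by nlinarith [Nat.zero_le (k * Δ), Nat.zero_le (k * Δ * Δ)]) hV)
  obtain ⟨H, hHcard, hH⟩ := exists_raise f k hf v₁ hv₁ p (by omega) (by omega) (1, 0)
  obtain ⟨g, hg⟩ : ∃ g : V → ℕ × ℕ, g = fun v => if v ∈ H then f v + (1, 0) else f v := ⟨_, rfl⟩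
  have hg₁ : ∀ v, (g v).1 = (f v).1 + if v ∈ H then 1 else 0 := by
    intro v; rw [hg]; simp only; split_ifs <;> simp
  have hg₂ : ∀ v, (g v).2 = (f v).2 := by
    intro v; rw [hg]; simp only; split_ifs <;> simp
  have hganon : ∀ v, k ≤ (Finset.univ.filter fun u => g u = g v).card := by
    rw [hg]; exact hH
  obtain ⟨v₂, hv₂⟩ := exists_large_fiber g (Δ + 2) (Δ + 1) (4 * k)
    (fun v => by rw [hg₁]; have := hf₁ v; split_ifs <;> omega)
    (fun v => by rw [hg₂]; exact Nat.lt_succ_of_le (hf₂ v))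
    (lt_of_le_of_lt (by nlinarith [Nat.zero_le (k * Δ), Nat.zero_le (k * Δ * Δ)]) hV)
  obtain ⟨L, hLcard, hL⟩ := exists_raise g k hganon v₂ hv₂ q (by omega) (by omega) (0, 1)
  obtain ⟨h, hh⟩ : ∃ h : V → ℕ × ℕ, h = fun v => if v ∈ L then g v + (0, 1) else g v := ⟨_, rfl⟩
  have hh₁ : ∀ v, (h v).1 = (f v).1 + if v ∈ H then 1 else 0 := by
    intro v; rw [← hg₁, hh]; simp only; split_ifs <;> simp
  have hh₂ : ∀ v, (h v).2 = (f v).2 + if v ∈ L then 1 else 0 := by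
    intro v; rw [← hg₂, hh]; simp only; split_ifs <;> simp
  have hhanon : ∀ v, k ≤ (Finset.univ.filter fun u => h u = h v).card := by
    rw [hh]; exact hL
  have hd₁ : ∀ v, (deg A v).1 ≤ (h v).1 := fun v => by
    rw [hh₁]; exact (hdf v).1.trans (Nat.le_add_right _ _)
  have hd₂ : ∀ v, (deg A v).2 ≤ (h v).2 := fun v => by
    rw [hh₂]; exact (hdf v).2.trans (Nat.le_add_right _ _)
  have hsum₁ : ∑ v, (h v).1 = ∑ v, (deg A v).1 + M := by
    simp only [hh₁, Finset.sum_add_distrib, Finset.sum_ite_mem, Finset.univ_inter,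
      Finset.sum_const, smul_eq_mul, mul_one]
    omega
  have hsum₂ : ∑ v, (h v).2 = ∑ v, (deg A v).2 + M := by
    simp only [hh₂, Finset.sum_add_distrib, Finset.sum_ite_mem, Finset.univ_inter,
      Finset.sum_const, smul_eq_mul, mul_one]
    omega
  have hx : ∑ v, ((h v).1 - (deg A v).1) = M := by
    rw [Finset.sum_tsub_distrib _ fun v _ => hd₁ v, hsum₁, Nat.add_sub_cancel_left]
  have hy : ∑ v, ((h v).2 - (deg A v).2) = M := by
    rw [Finset.sum_tsub_distrib _ fun v _ => hd₂ v, hsum₂, Nat.add_sub_cancel_left]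
  obtain ⟨S, hSA, hSl, hSin, hSout⟩ := exists_realization A (fun v => (h v).1 - (deg A v).1)
    (fun v => (h v).2 - (deg A v).2) (Δ + 1) M
    (fun v => by simp only [hh₁]; have := hf₁ v; split_ifs <;> omega)
    (fun v => by simp only [hh₂]; have := hf₂ v; split_ifs <;> omega) hx hy
    (by
      have h1 : 3 * ((Δ + 1) * (Δ + (Δ + 1))) + 2 * 4 < 8 * (Δ + 2) ^ 2 := by nlinarith
      have h2 : 2 * (4 * (Δ + 2) ^ 2 - 1) ≤ k * (4 * (Δ + 2) ^ 2 - 1) := by gcongr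
      have h3 : k * (4 * (Δ + 2) ^ 2 - 1) + k = 4 * k * (Δ + 2) ^ 2 := by
        have : 0 < (Δ + 2) ^ 2 := by positivity
        obtain ⟨r, hr⟩ : ∃ r, 4 * (Δ + 2) ^ 2 = r + 1 := ⟨4 * (Δ + 2) ^ 2 - 1, by omega⟩
        rw [show 4 * k * (Δ + 2) ^ 2 = k * (4 * (Δ + 2) ^ 2) by ring, hr]
        simp [mul_add]
      rw [← hΔ]
      omega)
  have hdeg : ∀ v, deg (A ∪ S) v = h v := by
    intro v
    have e1 := hd₁ v
    have e2 := hd₂ v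
    have e3 := hSin v
    have e4 := hSout v
    refine Prod.ext ?_ ?_
    · change inDeg (A ∪ S) v = _
      rw [inDeg_union hSA]
      simp only [deg] at e1 e3
      omega
    · change outDeg (A ∪ S) v = _
      rw [outDeg_union hSA]
      simp only [deg] at e2 e4
      omega
  refine ⟨S, hSA, hSl, fun v => ?_, ?_⟩
  · simp only [hdeg]
    exact hhanon v
  · rw [← sum_inDeg, Finset.sum_congr rfl fun v _ => hSin v, hx]
    omega

/-- **Degree bound for minimum k-insertion sets.** If `S` is a minimum-size
`k`-insertion set for `D`, then `Δ_{D+S} ≤ 4k(Δ_D + 2)² + Δ_D`. -/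
theorem min_insertion_set_maxdeg_bound {V : Type*} [Fintype V] [DecidableEq V]
    (A : Finset (V × V)) (hA : ∀ v : V, (v, v) ∉ A)
    (k : ℕ) (hk : 0 < k)
    (S : Finset (V × V))
    (hSA : ∀ a ∈ S, a ∉ A) (hSloop : ∀ v : V, (v, v) ∉ S)
    (hanon : kAnonymous (A ∪ S) k)
    (hmin : ∀ S' : Finset (V × V),
      (∀ a ∈ S', a ∉ A) → (∀ v : V, (v, v) ∉ S') → kAnonymous (A ∪ S') k →
      S.card ≤ S'.card) :
    maxDeg (A ∪ S) ≤ 4 * k * (maxDeg A + 2) ^ 2 + maxDeg A := by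
  by_contra hlarge
  obtain ⟨v, hv⟩ : ∃ v, 4 * k * (maxDeg A + 2) ^ 2 < inDeg S v ∨
      4 * k * (maxDeg A + 2) ^ 2 < outDeg S v := by
    by_contra! hsmall
    refine hlarge (Finset.sup_le fun v _ => max_le ?_ ?_)
    · rw [inDeg_union hSA, add_comm]
      exact Nat.add_le_add (hsmall v).1 (inDeg_le_maxDeg A v)
    · rw [outDeg_union hSA, add_comm]
      exact Nat.add_le_add (hsmall v).2 (outDeg_le_maxDeg A v)
  have hcard : 4 * k * (maxDeg A + 2) ^ 2 < S.card :=
    hv.elim (fun h => h.trans_le (Finset.card_filter_le _ _))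
      fun h => h.trans_le (Finset.card_filter_le _ _)
  have hV : 4 * k * (maxDeg A + 2) ^ 2 < Fintype.card V :=
    hv.elim (fun h => h.trans_le (inDeg_le_card S v)) fun h => h.trans_le (outDeg_le_card S v)
  obtain rfl | hk2 : k = 1 ∨ 2 ≤ k := by omega
  · have := hmin ∅ (by simp) (by simp) fun w => Finset.card_pos.2 ⟨w, by simp⟩
    rw [Finset.card_empty] at this
    omega
  · obtain ⟨S', hS'A, hS'l, hS'anon, hS'card⟩ := exists_small_insertion_set A k hk2 hV
    have := hmin S' hS'A hS'l hS'anon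
    omega
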